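/- Let f, f̃ be p.d.f.s of two standard mixtures of k spherical Gaussians in ℝ^d with means of length at most √d. There exist universal constants c₀ = 8πe, c₁ = 36 such that for every ε ≤ exp(−c₁d), if for R = c₀·log(1/ε) and all 1 ≤ r ≤ R the mean moments satisfy ‖(1/k)Σ_j μ_j^{⊗r} − (1/k)Σ_j μ̃_j^{⊗r}‖_{inj} ≤ ε·(r/(8πe√(log(1/ε))))^r, then ‖f − f̃‖₂ ≤ ε. -/

import Mathlib

open Real MeasureTheory
open scoped RealInnerProductSpace

lemma norm_sum_mul_cexp_le {ι : Type*} [Fintype ι] (c t : ι → ℝ) (T : ℝ) (n : ℕ)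
    (ht : ∀ i, |t i| ≤ T) (hT : T ≤ (n + 1 : ℝ) / 2) :
    ‖∑ i, (c i : ℂ) * Complex.exp (t i * Complex.I)‖ ≤
      ∑ m ∈ Finset.range n, |∑ i, c i * t i ^ m| / m.factorial
        + (∑ i, |c i|) * (T ^ n / n.factorial * 2) := by
  have hsplit : ∑ i, (c i : ℂ) * Complex.exp (t i * Complex.I) =
      ∑ m ∈ Finset.range n, Complex.I ^ m * ((∑ i, c i * t i ^ m : ℝ) : ℂ) / m.factorial +
      ∑ i, (c i : ℂ) * (Complex.exp (t i * Complex.I) -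
        ∑ m ∈ Finset.range n, (t i * Complex.I) ^ m / m.factorial) := by
    simp only [mul_sub, Finset.sum_sub_distrib, Complex.ofReal_sum, Finset.mul_sum,
      Finset.sum_div]
    rw [Finset.sum_comm, eq_comm, add_comm, sub_add_eq_add_sub, sub_eq_iff_eq_add]
    congr 1
    refine Finset.sum_congr rfl fun i _ => Finset.sum_congr rfl fun m _ => ?_
    push_cast
    ring
  rw [hsplit]
  refine (norm_add_le _ _).trans (add_le_add ?_ ?_)
  · refine (norm_sum_le _ _).trans (Finset.sum_le_sum fun m _ => le_of_eq ?_)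
    rw [norm_div, norm_mul, norm_pow, Complex.norm_I, one_pow, one_mul, Complex.norm_real,
      Complex.norm_natCast, Real.norm_eq_abs]
  · rw [Finset.sum_mul]
    refine (norm_sum_le _ _).trans (Finset.sum_le_sum fun i _ => ?_)
    rw [norm_mul, Complex.norm_real, Real.norm_eq_abs]
    have hn : ‖(t i : ℂ) * Complex.I‖ = |t i| := by simp
    refine mul_le_mul_of_nonneg_left ?_ (abs_nonneg _)
    refine (Complex.exp_bound' ?_).trans ?_
    · rw [hn, div_le_iff₀ (by positivity)]
      push_cast
      linarith [ht i]
    · rw [hn]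
      gcongr
      exact ht i

lemma ofReal_exp_mul_exp_eq {E : Type*} [NormedAddCommGroup E] [InnerProductSpace ℝ E]
    (a b x : E) :
    ((Real.exp (-π * ‖x - a‖ ^ 2) * Real.exp (-π * ‖x - b‖ ^ 2) : ℝ) : ℂ) =
      ((Real.exp (-π * (‖a‖ ^ 2 + ‖b‖ ^ 2)) : ℝ) : ℂ) *
      Complex.exp (-(2 * π : ℂ) * ‖x‖ ^ 2 + 2 * π * ⟪a + b, x⟫) := by
  have h : -π * ‖x - a‖ ^ 2 + -π * ‖x - b‖ ^ 2 =
      -π * (‖a‖ ^ 2 + ‖b‖ ^ 2) + (-(2 * π) * ‖x‖ ^ 2 + 2 * π * ⟪a + b, x⟫) := by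
    rw [norm_sub_sq_real, norm_sub_sq_real, inner_add_left, real_inner_comm a x,
      real_inner_comm b x]
    ring
  rw [← Real.exp_add, h, Real.exp_add]
  push_cast
  rfl

lemma two_pi_re_pos : 0 < (2 * π : ℂ).re := by
  simp [Real.pi_pos]

section
variable {E : Type*} [NormedAddCommGroup E] [InnerProductSpace ℝ E] [FiniteDimensional ℝ E]
  [MeasurableSpace E] [BorelSpace E]

lemma integrable_exp_neg_mul_sq_norm {b : ℝ} (hb : 0 < b) :
    Integrable (fun x : E => Real.exp (-b * ‖x‖ ^ 2)) := by
  refine Integrable.of_integral_ne_zero ?_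
  rw [GaussianFourier.integral_rexp_neg_mul_sq_norm hb]
  positivity

lemma integrable_exp_mul_exp (a b : E) :
    Integrable (fun x : E => Real.exp (-π * ‖x - a‖ ^ 2) * Real.exp (-π * ‖x - b‖ ^ 2)) := by
  have h := ((GaussianFourier.integrable_cexp_neg_mul_sq_norm_add two_pi_re_pos (2 * π)
    (a + b)).const_mul ((Real.exp (-π * (‖a‖ ^ 2 + ‖b‖ ^ 2)) : ℝ) : ℂ)).re
  refine h.congr (Filter.Eventually.of_forall fun x => ?_)
  have := congrArg Complex.re (ofReal_exp_mul_exp_eq a b x)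
  rw [Complex.ofReal_re] at this
  exact this.symm

lemma integral_exp_mul_exp_eq_integral_cexp (a b : E) :
    ((∫ x : E, Real.exp (-π * ‖x - a‖ ^ 2) * Real.exp (-π * ‖x - b‖ ^ 2) : ℝ) : ℂ) =
      ∫ x : E, Complex.exp (-(2 * π : ℂ) * ‖x‖ ^ 2 + 2 * π * Complex.I * ⟪a - b, x⟫) := by
  have hπ : (π : ℂ) ≠ 0 := by exact_mod_cast Real.pi_ne_zero
  rw [← integral_complex_ofReal]
  simp_rw [ofReal_exp_mul_exp_eq]
  rw [integral_const_mul, GaussianFourier.integral_cexp_neg_mul_sq_norm_add two_pi_re_pos,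
    GaussianFourier.integral_cexp_neg_mul_sq_norm_add two_pi_re_pos, mul_left_comm]
  congr 1
  rw [Complex.ofReal_exp, ← Complex.exp_add]
  congr 1
  have h : ((‖a + b‖ ^ 2 : ℝ) : ℂ) + ((‖a - b‖ ^ 2 : ℝ) : ℂ) =
      ((2 * (‖a‖ ^ 2 + ‖b‖ ^ 2) : ℝ) : ℂ) := by
    rw [← Complex.ofReal_add, norm_add_sq_real, norm_sub_sq_real]
    congr 1
    ring
  push_cast at h ⊢
  rw [mul_pow _ Complex.I, Complex.I_sq]
  field_simp
  linear_combination 2 * h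

/-- Parseval's identity for a finite combination of Gaussians. -/
lemma integral_sq_sum_exp_eq {ι : Type*} [Fintype ι] (c : ι → ℝ) (a : ι → E) :
    ∫ x : E, (∑ i, c i * Real.exp (-π * ‖x - a i‖ ^ 2)) ^ 2 =
      ∫ x : E, ‖∑ i, (c i : ℂ) * Complex.exp ((2 * π * ⟪a i, x⟫ : ℝ) * Complex.I)‖ ^ 2 *
        Real.exp (-(2 * π) * ‖x‖ ^ 2) := by
  have h1 : ∀ x : E, (∑ i, c i * Real.exp (-π * ‖x - a i‖ ^ 2)) ^ 2 =
      ∑ i, ∑ j, c i * c j *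
        (Real.exp (-π * ‖x - a i‖ ^ 2) * Real.exp (-π * ‖x - a j‖ ^ 2)) := fun x => by
    rw [sq, Finset.sum_mul_sum]
    refine Finset.sum_congr rfl fun i _ => Finset.sum_congr rfl fun j _ => by ring
  have h2 : ∀ x : E, ((‖∑ i, (c i : ℂ) * Complex.exp ((2 * π * ⟪a i, x⟫ : ℝ) * Complex.I)‖ ^ 2 *
        Real.exp (-(2 * π) * ‖x‖ ^ 2) : ℝ) : ℂ) =
      ∑ i, ∑ j, ((c i * c j : ℝ) : ℂ) *
        Complex.exp (-(2 * π : ℂ) * ‖x‖ ^ 2 + 2 * π * Complex.I * ⟪a i - a j, x⟫) := fun x => by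
    rw [Complex.ofReal_mul, Complex.ofReal_pow, ← Complex.mul_conj', map_sum, Finset.sum_mul_sum,
      Finset.sum_mul]
    refine Finset.sum_congr rfl fun i _ => ?_
    rw [Finset.sum_mul]
    refine Finset.sum_congr rfl fun j _ => ?_
    rw [map_mul, Complex.conj_ofReal, ← Complex.exp_conj, map_mul, Complex.conj_ofReal,
      Complex.conj_I, Complex.ofReal_exp, mul_mul_mul_comm, ← Complex.exp_add, mul_assoc,
      ← Complex.exp_add, inner_sub_left, Complex.ofReal_mul (c i)]
    congr 2
    push_cast
    ring
  apply Complex.ofReal_injective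
  rw [← integral_complex_ofReal (f := fun x : E => ‖_‖ ^ 2 * _)]
  simp_rw [h2, h1]
  rw [integral_finsetSum _ fun i _ => integrable_finsetSum _ fun j _ =>
      (integrable_exp_mul_exp (a i) (a j)).const_mul _,
    integral_finsetSum _ fun i _ => integrable_finsetSum _ fun j _ =>
      (GaussianFourier.integrable_cexp_neg_mul_sq_norm_add two_pi_re_pos _ _).const_mul _,
    Complex.ofReal_sum]
  refine Finset.sum_congr rfl fun i _ => ?_
  rw [integral_finsetSum _ fun j _ => (integrable_exp_mul_exp (a i) (a j)).const_mul _,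
    integral_finsetSum _ fun j _ =>
      (GaussianFourier.integrable_cexp_neg_mul_sq_norm_add two_pi_re_pos _ _).const_mul _,
    Complex.ofReal_sum]
  refine Finset.sum_congr rfl fun j _ => ?_
  rw [integral_const_mul, integral_const_mul, Complex.ofReal_mul,
    integral_exp_mul_exp_eq_integral_cexp]

end

lemma pow_self_div_factorial_le (n : ℕ) : (n : ℝ) ^ n / n.factorial ≤ Real.exp 1 ^ n := by
  rw [← Real.exp_nat_mul, mul_one]
  exact Real.pow_div_factorial_le_exp _ n.cast_nonneg n

lemma div_exp_one_pow_div_factorial_le {x : ℝ} (hx : 0 ≤ x) (n : ℕ) :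
    (n * (x / Real.exp 1)) ^ n / n.factorial ≤ x ^ n := by
  rw [mul_pow, div_pow, mul_div_right_comm]
  calc (n : ℝ) ^ n / n.factorial * (x ^ n / Real.exp 1 ^ n)
      ≤ Real.exp 1 ^ n * (x ^ n / Real.exp 1 ^ n) := by
        gcongr
        exact pow_self_div_factorial_le n
    _ = x ^ n := by field_simp

lemma sum_range_half_pow_succ_le_one (n : ℕ) :
    ∑ m ∈ Finset.range n, (1 / 2 : ℝ) ^ (m + 1) ≤ 1 := by
  have h : ∑ m ∈ Finset.range n, (1 / 2 : ℝ) ^ (m + 1) = 1 - (1 / 2) ^ n := by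
    induction n with
    | zero => simp
    | succ n ih => rw [Finset.sum_range_succ, ih, pow_succ]; ring
  rw [h]
  have : (0 : ℝ) ≤ (1 / 2) ^ n := by positivity
  linarith

lemma exp_neg_le_of_le {L : ℝ} (hL : 36 ≤ L) : Real.exp (-L) ≤ 1 / 400 := by
  rw [Real.exp_neg, one_div]
  refine inv_anti₀ (by norm_num) ?_
  have h' : Real.exp 36 = Real.exp 12 ^ 3 := by rw [← Real.exp_nat_mul]; norm_num
  have h : (13 : ℝ) ≤ Real.exp 12 := by linarith [Real.add_one_le_exp (12 : ℝ)]
  calc (400 : ℝ) ≤ 13 ^ 3 := by norm_num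
    _ ≤ Real.exp 12 ^ 3 := by gcongr
    _ ≤ Real.exp L := h' ▸ Real.exp_le_exp.2 hL

lemma one_twelfth_pow_le {n : ℕ} {L : ℝ} (hL : 36 ≤ L) (hn : L ≤ n) :
    (1 / 12 : ℝ) ^ n ≤ Real.exp (-L) / 400 := by
  have h12 : (1 / 12 : ℝ) ≤ Real.exp (-2) := by
    rw [Real.exp_neg, one_div]
    refine inv_anti₀ (Real.exp_pos _) ?_
    have h := Real.exp_one_lt_d9
    have h' : Real.exp 2 = Real.exp 1 ^ 2 := by rw [← Real.exp_nat_mul]; norm_num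
    rw [h']
    nlinarith [Real.exp_pos 1]
  calc (1 / 12 : ℝ) ^ n ≤ Real.exp (-2) ^ n := by gcongr
    _ = Real.exp (n * -2) := (Real.exp_nat_mul _ _).symm
    _ ≤ Real.exp (-L + -36) := Real.exp_le_exp.2 (by linarith)
    _ = Real.exp (-L) * Real.exp (-36) := Real.exp_add _ _
    _ ≤ Real.exp (-L) * (1 / 400) := by gcongr; exact exp_neg_le_of_le le_rfl
    _ = _ := by ring

section
variable {E : Type*} [NormedAddCommGroup E] [InnerProductSpace ℝ E]

/-- Low-frequency bound: closeness of the moments controls the characteristic function. -/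
lemma norm_sum_mul_cexp_inner_le_of_moments {ι : Type*} [Fintype ι] (c : ι → ℝ) (a : ι → E)
    {D L ε : ℝ} (hL : 36 ≤ L) (hDL : 36 * D ≤ L) (hε : Real.exp (-L) = ε)
    (hc : ∑ i, |c i| ≤ 2) (hc0 : ∑ i, c i = 0) (ha : ∀ i, ‖a i‖ ≤ √D)
    (hmom : ∀ r : ℕ, 1 ≤ r → (r : ℝ) ≤ 8 * π * Real.exp 1 * L → ∀ y : E, ‖y‖ = 1 →
      |∑ i, c i * ⟪a i, y⟫ ^ r| ≤ ε * (r / (8 * π * Real.exp 1 * √L)) ^ r)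
    {x : E} (hx : ‖x‖ ≤ 2 * √L) :
    ‖∑ i, (c i : ℂ) * Complex.exp ((2 * π * ⟪a i, x⟫ : ℝ) * Complex.I)‖ ≤ 101 / 100 * ε := by
  have hε0 : 0 < ε := hε ▸ Real.exp_pos _
  have he1 : 1 ≤ Real.exp 1 := Real.one_le_exp zero_le_one
  have hπ := Real.pi_gt_three
  have hL0 : 0 < L := by linarith
  have hsL : 0 < √L := Real.sqrt_pos.2 hL0
  have hLL : √L * √L = L := Real.mul_self_sqrt hL0.le
  have hR : 0 ≤ 8 * π * Real.exp 1 * L := by positivity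
  set N : ℕ := ⌊8 * π * Real.exp 1 * L⌋₊ with hN
  have hn : 8 * π * Real.exp 1 * L ≤ ((N + 1 : ℕ) : ℝ) := by
    push_cast
    exact (Nat.lt_floor_add_one _).le
  have hsD : √D ≤ √L / 6 := by
    rw [Real.sqrt_le_left (by positivity), div_pow, Real.sq_sqrt hL0.le]
    linarith
  have ht : ∀ i, |2 * π * ⟪a i, x⟫| ≤ 2 * π / 3 * L := fun i => by
    rw [abs_mul, abs_of_pos (by positivity : 0 < 2 * π)]
    have : |⟪a i, x⟫| ≤ √L / 6 * (2 * √L) :=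
      (abs_real_inner_le_norm _ _).trans (by gcongr; exact (ha i).trans hsD)
    calc 2 * π * |⟪a i, x⟫| ≤ 2 * π * (√L / 6 * (2 * √L)) := by gcongr
      _ = 2 * π / 3 * (√L * √L) := by ring
      _ = _ := by rw [hLL]
  have hT : 2 * π / 3 * L ≤ ((N + 1 : ℕ) : ℝ) * (1 / 12 / Real.exp 1) := by
    calc 2 * π / 3 * L = 8 * π * Real.exp 1 * L * (1 / 12 / Real.exp 1) := by
          field_simp; norm_num
      _ ≤ _ := by gcongr
  have hT' : 2 * π / 3 * L ≤ (((N + 1 : ℕ) : ℝ) + 1) / 2 := by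
    refine hT.trans ?_
    have : 1 / 12 / Real.exp 1 ≤ 1 / 2 := by
      rw [div_le_iff₀ (Real.exp_pos 1)]; linarith
    calc _ ≤ ((N + 1 : ℕ) : ℝ) * (1 / 2) := by gcongr
      _ ≤ _ := by linarith
  have hLN : L ≤ ((N + 1 : ℕ) : ℝ) := by
    refine le_trans ?_ hn
    have : 1 ≤ 8 * π * Real.exp 1 := by nlinarith
    exact le_mul_of_one_le_left hL0.le this
  refine (norm_sum_mul_cexp_le c _ _ (N + 1) ht hT').trans ?_
  have htail : (∑ i, |c i|) * ((2 * π / 3 * L) ^ (N + 1) / (N + 1).factorial * 2) ≤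
      1 / 100 * ε := by
    have h1 : (2 * π / 3 * L) ^ (N + 1) / (N + 1).factorial ≤ ε / 400 := by
      calc _ ≤ (((N + 1 : ℕ) : ℝ) * (1 / 12 / Real.exp 1)) ^ (N + 1) / (N + 1).factorial := by
            gcongr
        _ ≤ (1 / 12) ^ (N + 1) := div_exp_one_pow_div_factorial_le (by norm_num) _
        _ ≤ Real.exp (-L) / 400 := one_twelfth_pow_le hL hLN
        _ = ε / 400 := by rw [hε]
    calc _ ≤ 2 * (ε / 400 * 2) := by gcongr
      _ = _ := by ring
  have hmain : ∑ m ∈ Finset.range (N + 1),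
      |∑ i, c i * (2 * π * ⟪a i, x⟫) ^ m| / m.factorial ≤ ε := by
    rw [Finset.sum_range_succ']
    simp only [pow_zero, mul_one, hc0, abs_zero, zero_div, add_zero]
    calc _ ≤ ∑ m ∈ Finset.range N, ε * (1 / 2) ^ (m + 1) := Finset.sum_le_sum fun m hm => ?_
      _ = ε * ∑ m ∈ Finset.range N, (1 / 2) ^ (m + 1) := (Finset.mul_sum _ _ _).symm
      _ ≤ ε * 1 := by gcongr; exact sum_range_half_pow_succ_le_one N
      _ = ε := mul_one ε
    set r := m + 1 with hr
    have hrR : (r : ℝ) ≤ 8 * π * Real.exp 1 * L :=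
      (Nat.le_floor_iff hR).1 (Finset.mem_range.1 hm)
    rcases eq_or_ne x 0 with rfl | hx0
    · simp only [inner_zero_right, mul_zero, zero_pow (Nat.succ_ne_zero m), hr,
        Finset.sum_const_zero, abs_zero, zero_div]
      positivity
    have hxn : ‖x‖ ≠ 0 := norm_ne_zero_iff.2 hx0
    have hu : ‖(‖x‖⁻¹ • x : E)‖ = 1 := by rw [norm_smul, norm_inv, norm_norm, inv_mul_cancel₀ hxn]
    have hmu := hmom r (Nat.succ_pos m) hrR _ hu
    have hsum : ∑ i, c i * (2 * π * ⟪a i, x⟫) ^ r =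
        (2 * π * ‖x‖) ^ r * ∑ i, c i * ⟪a i, ‖x‖⁻¹ • x⟫ ^ r := by
      rw [Finset.mul_sum]
      refine Finset.sum_congr rfl fun i _ => ?_
      rw [inner_smul_right, mul_left_comm, ← mul_pow]
      congr 2
      field_simp
    rw [hsum, abs_mul, abs_of_nonneg (by positivity)]
    calc (2 * π * ‖x‖) ^ r * |∑ i, c i * ⟪a i, ‖x‖⁻¹ • x⟫ ^ r| / r.factorial
        ≤ (2 * π * (2 * √L)) ^ r * (ε * (r / (8 * π * Real.exp 1 * √L)) ^ r) / r.factorial := by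
          gcongr
      _ = ε * ((r * (1 / 2 / Real.exp 1)) ^ r / r.factorial) := by
          rw [mul_left_comm, ← mul_pow, mul_div_assoc]
          congr 3
          field_simp
          ring
      _ ≤ _ := by gcongr; exact div_exp_one_pow_div_factorial_le (by norm_num) r
  linarith

lemma norm_sum_mul_cexp_ofReal_mul_I_le {ι : Type*} [Fintype ι] (c t : ι → ℝ) :
    ‖∑ i, (c i : ℂ) * Complex.exp ((t i : ℝ) * Complex.I)‖ ≤ ∑ i, |c i| := by
  refine (norm_sum_le _ _).trans (Finset.sum_le_sum fun i _ => ?_)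
  rw [norm_mul, Complex.norm_exp_ofReal_mul_I, Complex.norm_real, mul_one, Real.norm_eq_abs]

lemma exp_neg_two_pi_mul_sq_le {L s : ℝ} (hL : 36 ≤ L) (hs : 2 * √L ≤ s) :
    4 * Real.exp (-(2 * π) * s ^ 2) ≤
      1 / 100 * Real.exp (-L) ^ 2 * Real.exp (-π * s ^ 2) := by
  have hs2 : 4 * L ≤ s ^ 2 := by
    calc 4 * L = (2 * √L) ^ 2 := by rw [mul_pow, Real.sq_sqrt (by linarith)]; norm_num
      _ ≤ _ := by gcongr
  have h400 : Real.exp (-L) ≤ 1 / 400 := exp_neg_le_of_le hL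
  have hexp : Real.exp (-(2 * π) * s ^ 2) ≤ Real.exp (-L) ^ 3 * Real.exp (-π * s ^ 2) := by
    rw [← Real.exp_nat_mul, ← Real.exp_add, Real.exp_le_exp]
    push_cast
    nlinarith [Real.pi_gt_three]
  calc _ ≤ 4 * (Real.exp (-L) ^ 3 * Real.exp (-π * s ^ 2)) := by gcongr
    _ = 4 * Real.exp (-L) * (Real.exp (-L) ^ 2 * Real.exp (-π * s ^ 2)) := by ring
    _ ≤ 4 * (1 / 400) * (Real.exp (-L) ^ 2 * Real.exp (-π * s ^ 2)) := by gcongr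
    _ = _ := by ring

end

lemma half_rpow_le {d : ℕ} (hd : 1 ≤ d) : (1 / 2 : ℝ) ^ (d / 2 : ℝ) ≤ 3 / 4 := by
  have hd' : (1 : ℝ) ≤ d := by exact_mod_cast hd
  calc (1 / 2 : ℝ) ^ (d / 2 : ℝ) ≤ (1 / 2) ^ (1 / 2 : ℝ) :=
        Real.rpow_le_rpow_of_exponent_ge (by norm_num) (by norm_num) (by linarith)
    _ = √(1 / 2) := (Real.sqrt_eq_rpow _).symm
    _ ≤ 3 / 4 := by rw [Real.sqrt_le_left (by norm_num)]; norm_num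

/-- A signed combination of Gaussians with nearly vanishing moments is small in `L²`. -/
lemma integral_sq_sum_exp_le_of_moments {d : ℕ} (hd : 1 ≤ d) {ι : Type*} [Fintype ι]
    (c : ι → ℝ) (a : ι → EuclideanSpace ℝ (Fin d)) {L ε : ℝ} (hL : 36 * (d : ℝ) ≤ L)
    (hε : Real.exp (-L) = ε) (hc : ∑ i, |c i| ≤ 2) (hc0 : ∑ i, c i = 0) (ha : ∀ i, ‖a i‖ ≤ √d)
    (hmom : ∀ r : ℕ, 1 ≤ r → (r : ℝ) ≤ 8 * π * Real.exp 1 * L →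
      ∀ y : EuclideanSpace ℝ (Fin d), ‖y‖ = 1 →
        |∑ i, c i * ⟪a i, y⟫ ^ r| ≤ ε * (r / (8 * π * Real.exp 1 * √L)) ^ r) :
    ∫ x, (∑ i, c i * Real.exp (-π * ‖x - a i‖ ^ 2)) ^ 2 ≤ ε ^ 2 := by
  have hd' : (1 : ℝ) ≤ d := by exact_mod_cast hd
  have hL' : 36 ≤ L := by linarith
  have hε0 : 0 < ε := hε ▸ Real.exp_pos _
  have hi₁ := (integrable_exp_neg_mul_sq_norm (E := EuclideanSpace ℝ (Fin d))
    Real.two_pi_pos).const_mul ((101 / 100 * ε) ^ 2)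
  have hi₂ := (integrable_exp_neg_mul_sq_norm (E := EuclideanSpace ℝ (Fin d))
    Real.pi_pos).const_mul (1 / 100 * ε ^ 2)
  rw [integral_sq_sum_exp_eq]
  calc _ ≤ ∫ x : EuclideanSpace ℝ (Fin d), ((101 / 100 * ε) ^ 2 * Real.exp (-(2 * π) * ‖x‖ ^ 2) +
        1 / 100 * ε ^ 2 * Real.exp (-π * ‖x‖ ^ 2)) := by
        refine integral_mono_of_nonneg (Filter.Eventually.of_forall fun x => by positivity)
          (hi₁.add hi₂) (Filter.Eventually.of_forall fun x => ?_)
        dsimp only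
        rcases le_total ‖x‖ (2 * √L) with hx | hx
        · have h := norm_sum_mul_cexp_inner_le_of_moments c a hL' hL hε hc hc0 ha
            hmom hx
          refine le_add_of_le_of_nonneg ?_ (by positivity)
          gcongr
        · refine le_add_of_nonneg_of_le (by positivity) ?_
          refine le_trans ?_ ((exp_neg_two_pi_mul_sq_le hL' hx).trans_eq (by rw [hε]))
          have h := (norm_sum_mul_cexp_ofReal_mul_I_le c fun i => 2 * π * ⟪a i, x⟫).trans hc
          calc _ ≤ 2 ^ 2 * Real.exp (-(2 * π) * ‖x‖ ^ 2) := by gcongr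
            _ = _ := by norm_num
    _ = (101 / 100 * ε) ^ 2 * (1 / 2) ^ (d / 2 : ℝ) + 1 / 100 * ε ^ 2 := by
        rw [integral_add hi₁ hi₂, integral_const_mul, integral_const_mul,
          GaussianFourier.integral_rexp_neg_mul_sq_norm Real.two_pi_pos,
          GaussianFourier.integral_rexp_neg_mul_sq_norm Real.pi_pos, finrank_euclideanSpace_fin,
          div_self Real.pi_ne_zero, Real.one_rpow, mul_one,
          show π / (2 * π) = 1 / 2 by field_simp]
    _ ≤ (101 / 100 * ε) ^ 2 * (3 / 4) + 1 / 100 * ε ^ 2 := by gcongr; exact half_rpow_le hd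
    _ ≤ ε ^ 2 := by nlinarith [sq_nonneg ε]

/-- Closeness of the first `R = 8πe·log(1/ε)` mean moments (in injective tensor norm,
expressed via unit directions `y`) implies `L²` closeness of the two standard mixture
densities, for `ε ≤ exp(-36 d)` and means bounded by `√d`. -/
theorem stmt_10 (d k : ℕ) (hk : 0 < k)
    (μ μt : Fin k → EuclideanSpace ℝ (Fin d))
    (hμ : ∀ j, ‖μ j‖ ≤ Real.sqrt d) (hμt : ∀ j, ‖μt j‖ ≤ Real.sqrt d)
    (ε : ℝ) (hε₀ : 0 < ε) (hε : ε ≤ Real.exp (-36 * d))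
    (f ft : EuclideanSpace ℝ (Fin d) → ℝ)
    (hf : ∀ x, f x = (1 / k) * ∑ j, Real.exp (-π * ‖x - μ j‖ ^ 2))
    (hft : ∀ x, ft x = (1 / k) * ∑ j, Real.exp (-π * ‖x - μt j‖ ^ 2))
    (hmom : ∀ r : ℕ, 1 ≤ r → (r : ℝ) ≤ 8 * π * Real.exp 1 * Real.log (1 / ε) →
      ∀ y : EuclideanSpace ℝ (Fin d), ‖y‖ = 1 →
        |(1 / k : ℝ) * ∑ j, ⟪μ j, y⟫ ^ r - (1 / k : ℝ) * ∑ j, ⟪μt j, y⟫ ^ r| ≤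
          ε * ((r : ℝ) / (8 * π * Real.exp 1 * Real.sqrt (Real.log (1 / ε)))) ^ r) :
    Real.sqrt (∫ x, (f x - ft x) ^ 2) ≤ ε := by
  have hk' : (k : ℝ) ≠ 0 := by exact_mod_cast hk.ne'
  rcases Nat.eq_zero_or_pos d with rfl | hd
  · have h0 : ∀ x, f x - ft x = 0 := fun x => by
      rw [hf, hft, sub_eq_zero]
      congr 2
      funext j
      rw [Subsingleton.elim (μ j) (μt j)]
    simp [h0, hε₀.le]
  · set c : Fin k ⊕ Fin k → ℝ := Sum.elim (fun _ => 1 / k) (fun _ => -(1 / k)) with hc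
    set a : Fin k ⊕ Fin k → EuclideanSpace ℝ (Fin d) := Sum.elim μ μt with ha
    have hL : 36 * (d : ℝ) ≤ Real.log (1 / ε) := by
      rw [one_div, Real.log_inv]
      have := (Real.log_le_iff_le_exp hε₀).2 hε
      linarith
    have hdiff : ∀ x, f x - ft x = ∑ i, c i * Real.exp (-π * ‖x - a i‖ ^ 2) := fun x => by
      rw [hf, hft, Fintype.sum_sum_type]
      simp only [hc, ha, Sum.elim_inl, Sum.elim_inr, ← Finset.mul_sum]
      ring
    have hmain := integral_sq_sum_exp_le_of_moments hd c a hL (ε := ε)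
      (by rw [one_div, Real.log_inv, neg_neg, Real.exp_log hε₀])
      (by
        rw [Fintype.sum_sum_type]
        simp only [hc, Sum.elim_inl, Sum.elim_inr, abs_neg, Finset.sum_const, Finset.card_univ,
          Fintype.card_fin, nsmul_eq_mul, abs_of_nonneg (by positivity : (0 : ℝ) ≤ 1 / k)]
        rw [mul_one_div_cancel hk']
        norm_num)
      (by
        rw [Fintype.sum_sum_type]
        simp [hc])
      (by
        rintro (j | j)
        exacts [hμ j, hμt j])
      (by
        intro r hr hrR y hy
        refine le_trans (le_of_eq ?_) (hmom r hr hrR y hy)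
        rw [Fintype.sum_sum_type]
        simp only [hc, ha, Sum.elim_inl, Sum.elim_inr, ← Finset.mul_sum]
        congr 1
        ring)
    simp_rw [hdiff]
    exact (Real.sqrt_le_left hε₀.le).2 hmain
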